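/- Fix an integer k ≥ 2 and x⁰ ∈ [0,1)^d, and set xⁿ := {kⁿ x⁰} (coordinatewise fractional part). Let q be a minimal idempotent ultrafilter on ℕ₀, let p ∈ βℕ₀ + q, and let S ⊆ [0,1)^d be a semialgebraic set. Suppose that x^q = x⁰ (the sequence xⁿ converges to x⁰ along q) and that xⁿ ∈ S for p-almost all n. Then the set {l ∈ ℕ : {l·x⁰} ∈ S} is IP*₊. -/

import Mathlib

/-- The basic semialgebraic set determined by equations `F` and strict inequalities `G`. -/
def basicSemialg {ι : Type} (F G : Finset (MvPolynomial ι ℝ)) : Set (ι → ℝ) :=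
  {x | (∀ f ∈ F, MvPolynomial.eval x f = 0) ∧ (∀ g ∈ G, 0 < MvPolynomial.eval x g)}

/-- A semialgebraic set: a finite union of basic semialgebraic sets. -/
def IsSemialgebraic {ι : Type} (S : Set (ι → ℝ)) : Prop :=
  ∃ (r : ℕ) (F G : Fin r → Finset (MvPolynomial ι ℝ)),
    S = ⋃ i, basicSemialg (F i) (G i)
/-- Finite sums of a sequence over nonempty finite index sets. -/
def FS (a : ℕ → ℕ) : Set ℕ :=
  {m : ℕ | ∃ I : Finset ℕ, I.Nonempty ∧ m = ∑ i ∈ I, a i}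

/-- A set is IP if it contains the finite sums of a sequence of positive integers. -/
def IsIP (A : Set ℕ) : Prop :=
  ∃ a : ℕ → ℕ, (∀ i, 0 < a i) ∧ FS a ⊆ A

/-- A set is IP* if it meets every IP set. -/
def IsIPStar (E : Set ℕ) : Prop :=
  ∀ A : Set ℕ, IsIP A → (E ∩ A).Nonempty

/-- A set is IP*₊ if some (integer) translate of it is an IP* set. -/
def IsIPStarPlus (E : Set ℕ) : Prop :=
  ∃ t : ℤ, IsIPStar {n : ℕ | ∃ m ∈ E, (m : ℤ) = (n : ℤ) + t}

/-- The sum of two ultrafilters on `ℕ`: `E ∈ usum p q ↔ {n | {m | n + m ∈ E} ∈ q} ∈ p`. -/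
def usum (p q : Ultrafilter ℕ) : Ultrafilter ℕ :=
  p.bind fun n => q.map fun m => n + m

open Filter Topology

theorem eventually_usum {p q : Ultrafilter ℕ} {P : ℕ → Prop} :
    (∀ᶠ n in (usum p q : Filter ℕ), P n) ↔
      ∀ᶠ n in (p : Filter ℕ), ∀ᶠ m in (q : Filter ℕ), P (n + m) :=
  Iff.rfl

/-- An ultrafilter lying in the left ideal `βℕ + r + q` of every `r` contains every tail of `ℕ`. -/
theorem eventually_ge_of_minimal {q : Ultrafilter ℕ}
    (hq : ∀ r : Ultrafilter ℕ, ∃ s : Ultrafilter ℕ, usum s (usum r q) = q) (N : ℕ) :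
    ∀ᶠ n in (q : Filter ℕ), N ≤ n := by
  obtain ⟨s, hs⟩ := hq (pure N)
  rw [← hs, eventually_usum]
  refine Eventually.of_forall fun a => ?_
  rw [eventually_usum]
  change N ∈ {n | ∀ᶠ m in (q : Filter ℕ), N ≤ a + (n + m)}
  exact Eventually.of_forall fun m => by omega

/-- Simultaneous Diophantine approximation along an IP set. -/
theorem IsIP.exists_dvd_and_abs_sub_lt {A : Set ℕ} (hA : IsIP A) {κ : Type*} [Finite κ]
    {b : ℕ} (hb : 0 < b) (a : κ → ℝ) {ε : ℝ} (hε : 0 < ε) :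
    ∃ l ∈ A, b ∣ l ∧ ∀ j, ∃ z : ℤ, |(l : ℝ) * a j - z| < ε := by
  obtain ⟨u, -, hu⟩ := hA
  obtain ⟨K, hK⟩ := exists_nat_one_div_lt hε
  have hK0 : (0 : ℝ) < K + 1 := by positivity
  have : NeZero b := ⟨hb.ne'⟩
  set s : ℕ → ℕ := fun N => ∑ i ∈ Finset.range N, u i
  have hfloor (N : ℕ) (j : κ) : ⌊Int.fract ((s N : ℝ) * a j) * (K + 1)⌋₊ < K + 1 := by
    rw [Nat.floor_lt (mul_nonneg (Int.fract_nonneg _) hK0.le)]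
    push_cast
    nlinarith [Int.fract_lt_one ((s N : ℝ) * a j)]
  let φ : ℕ → ZMod b × (κ → Fin (K + 1)) := fun N => (s N, fun j => ⟨_, hfloor N j⟩)
  obtain ⟨M, N, hMN, hφ⟩ := Finite.exists_ne_map_eq_of_infinite φ
  wlog hlt : M < N generalizing M N
  · exact this N M hMN.symm hφ.symm (by omega)
  have hsum : s N = s M + ∑ i ∈ Finset.Ico M N, u i :=
    (Finset.sum_range_add_sum_Ico _ hlt.le).symm
  have hφ1 : (s M : ZMod b) = s N := congrArg Prod.fst hφ
  refine ⟨∑ i ∈ Finset.Ico M N, u i, hu ⟨_, Finset.nonempty_Ico.2 hlt, rfl⟩, ?_, fun j => ?_⟩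
  · rw [hsum] at hφ1
    rw [← ZMod.natCast_eq_zero_iff]
    simpa using hφ1
  · have hφ2 := congrArg Fin.val (congrFun (congrArg Prod.snd hφ) j)
    simp only [φ] at hφ2
    refine ⟨⌊(s N : ℝ) * a j⌋ - ⌊(s M : ℝ) * a j⌋, ?_⟩
    have hcast : ((∑ i ∈ Finset.Ico M N, u i : ℕ) : ℝ) = s N - s M := by
      rw [hsum]; push_cast; ring
    have hdiff : ((∑ i ∈ Finset.Ico M N, u i : ℕ) : ℝ) * a j -
        ((⌊(s N : ℝ) * a j⌋ - ⌊(s M : ℝ) * a j⌋ : ℤ) : ℝ) =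
        Int.fract ((s N : ℝ) * a j) - Int.fract ((s M : ℝ) * a j) := by
      rw [hcast, Int.fract, Int.fract]; push_cast; ring
    rw [hdiff]
    refine lt_trans ?_ hK
    have h1 := Nat.floor_le (mul_nonneg (Int.fract_nonneg ((s M : ℝ) * a j)) hK0.le)
    have h2 := Nat.lt_floor_add_one (Int.fract ((s M : ℝ) * a j) * (K + 1))
    have h3 := Nat.floor_le (mul_nonneg (Int.fract_nonneg ((s N : ℝ) * a j)) hK0.le)
    have h4 := Nat.lt_floor_add_one (Int.fract ((s N : ℝ) * a j) * (K + 1))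
    rw [hφ2] at h1 h2
    rw [abs_lt, lt_div_iff₀ hK0, neg_lt, lt_div_iff₀ hK0]
    constructor <;> linarith

section

open MvPolynomial

variable {σ : Type*}

/-- The polynomial `y ↦ f (t • y + v)`. -/
noncomputable def affineComp (t : ℝ) (v : σ → ℝ) (f : MvPolynomial σ ℝ) : MvPolynomial σ ℝ :=
  aeval (fun i => C t * X i + C (v i)) f

theorem eval_affineComp (t : ℝ) (v y : σ → ℝ) (f : MvPolynomial σ ℝ) :
    eval y (affineComp t v f) = eval (t • y + v) f := by
  have : (eval y).comp (aeval (R := ℝ) fun i => C t * X i + C (v i)).toRingHom =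
      eval (t • y + v) := by
    ext <;> simp
  exact congrArg (fun φ : MvPolynomial σ ℝ →+* ℝ => φ f) this

/-- The ideal of polynomials vanishing at `y m` for eventually all `m`. -/
def eventualIdeal (l : Filter ℕ) (y : ℕ → σ → ℝ) : Ideal (MvPolynomial σ ℝ) where
  carrier := {f | ∀ᶠ m in l, eval (y m) f = 0}
  add_mem' hf hg := by
    filter_upwards [hf, hg] with m h1 h2
    simp [h1, h2]
  zero_mem' := by simp
  smul_mem' c f hf := by
    filter_upwards [hf] with m h
    simp [h]

theorem mem_eventualIdeal {l : Filter ℕ} {y : ℕ → σ → ℝ} {f : MvPolynomial σ ℝ} :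
    f ∈ eventualIdeal l y ↔ ∀ᶠ m in l, eval (y m) f = 0 :=
  Iff.rfl

/-- The eventual ideal is preserved by precomposition with `y ↦ t • y + v`. -/
def PreservesEventualIdeal (l : Filter ℕ) (y : ℕ → σ → ℝ) (t : ℝ) (v : σ → ℝ) : Prop :=
  ∀ f, (∀ᶠ m in l, eval (y m) f = 0) → ∀ᶠ m in l, eval (t • y m + v) f = 0

namespace PreservesEventualIdeal

variable {l : Filter ℕ} {y : ℕ → σ → ℝ}

theorem one_zero : PreservesEventualIdeal l y 1 0 := fun f hf => by simpa using hf

theorem comp {s t : ℝ} {u v : σ → ℝ} (hs : PreservesEventualIdeal l y s u)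
    (ht : PreservesEventualIdeal l y t v) :
    PreservesEventualIdeal l y (t * s) (t • u + v) := fun f hf => by
  have h := hs (affineComp t v f) (by simpa only [eval_affineComp] using ht f hf)
  simpa only [eval_affineComp, smul_add, smul_smul, add_assoc] using h

theorem pow {t : ℝ} {c : σ → ℝ} (h : PreservesEventualIdeal l y t ((1 - t) • c)) (j : ℕ) :
    PreservesEventualIdeal l y (t ^ j) ((1 - t ^ j) • c) := by
  induction j with
  | zero => simpa using one_zero
  | succ j ih =>
    convert! ih.comp h using 1
    · ring
    · ext i
      simp only [Pi.smul_apply, Pi.add_apply, smul_eq_mul]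
      ring

/-- If one nontrivial homothety centred at `c` preserves the ideal, then all of them do. -/
theorem homothety {t : ℝ} (ht : 1 < t) {c : σ → ℝ}
    (h : PreservesEventualIdeal l y t ((1 - t) • c)) (s : ℝ) :
    PreservesEventualIdeal l y s ((1 - s) • c) := fun f hf => by
  have hpow : ∀ᶠ m in l, ∀ j : Fin (f.totalDegree + 1),
      eval (t ^ (j : ℕ) • y m + (1 - t ^ (j : ℕ)) • c) f = 0 :=
    eventually_all.2 fun j => h.pow j f hf
  filter_upwards [hpow] with m hm
  let P : Polynomial ℝ :=
    aeval (fun i => Polynomial.C (y m i - c i) * Polynomial.X + Polynomial.C (c i)) f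
  have hP (r : ℝ) : P.eval r = eval (r • y m + (1 - r) • c) f := by
    have : (Polynomial.evalRingHom r).comp (aeval (R := ℝ) fun i =>
        Polynomial.C (y m i - c i) * Polynomial.X + Polynomial.C (c i)).toRingHom =
        eval (r • y m + (1 - r) • c) := by
      ext i
      · simp
      · simp; ring
    exact congrArg (fun φ : MvPolynomial σ ℝ →+* ℝ => φ f) this
  have hdeg : P.natDegree < f.totalDegree + 1 := by
    have := aeval_natDegree_le (n := 1) f le_rfl
      (fun i => Polynomial.C (y m i - c i) * Polynomial.X + Polynomial.C (c i))
      (fun i => Polynomial.natDegree_linear_le)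
    simp only [mul_one] at this
    exact Nat.lt_succ_of_le this
  have hP0 : P = 0 := by
    refine Polynomial.eq_zero_of_natDegree_lt_card_of_eval_eq_zero P
      (f := fun j : Fin (f.totalDegree + 1) => t ^ (j : ℕ)) ?_ (fun j => (hP _).trans (hm j))
      (by simpa using hdeg)
    intro i j hij
    exact Fin.ext (pow_right_injective₀ (by linarith) ht.ne' hij)
  rw [← hP, hP0, Polynomial.eval_zero]

theorem translation {c c' : σ → ℝ}
    (h : ∀ s : ℝ, PreservesEventualIdeal l y s ((1 - s) • c))
    (h' : ∀ s : ℝ, PreservesEventualIdeal l y s ((1 - s) • c')) (t : ℝ) :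
    PreservesEventualIdeal l y 1 (t • (c - c')) := by
  have key {t : ℝ} (ht : t ≠ 1) : PreservesEventualIdeal l y 1 (t • (c - c')) := by
    have ht' : 1 - t ≠ 0 := sub_ne_zero.2 ht.symm
    convert! (h' (1 - t)⁻¹).comp (h (1 - t)) using 1
    · field_simp
    · ext i
      simp only [Pi.smul_apply, Pi.add_apply, Pi.sub_apply, smul_eq_mul]
      field_simp
      ring
  rcases eq_or_ne t 1 with rfl | ht
  · convert! (key (t := 1 / 2) (by norm_num)).comp (key (t := 1 / 2) (by norm_num)) using 1
    · norm_num
    · ext i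
      simp only [Pi.smul_apply, Pi.add_apply, Pi.sub_apply, smul_eq_mul]
      ring
  · exact key ht

end PreservesEventualIdeal

end

/-- Along a filter under which `x` is recurrent for multiplication by `k` modulo one,
multiplication by `k ^ n` modulo one is eventually given by a single affine map. -/
theorem eventually_fract_pow_add {k : ℕ} {x : ℝ} {l : Filter ℕ}
    [l.NeBot] (hl : ∀ N : ℕ, ∀ᶠ m in l, N ≤ m)
    (hrec : Tendsto (fun m => Int.fract ((k : ℝ) ^ m * x)) l (𝓝 x)) (n : ℕ) :
    ∀ᶠ m in l, Int.fract ((k : ℝ) ^ (n + m) * x) =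
      (k : ℝ) ^ n * Int.fract ((k : ℝ) ^ m * x) - ⌊(k : ℝ) ^ n * x⌋ := by
  have hfloor : ∀ᶠ m in l,
      ⌊(k : ℝ) ^ n * Int.fract ((k : ℝ) ^ m * x)⌋ = ⌊(k : ℝ) ^ n * x⌋ := by
    rcases eq_or_ne (Int.fract ((k : ℝ) ^ n * x)) 0 with h0 | h0
    · have hzero : ∀ᶠ m in l, Int.fract ((k : ℝ) ^ m * x) = 0 := by
        filter_upwards [hl n] with m hm
        obtain ⟨j, rfl⟩ := Nat.exists_eq_add_of_le' hm
        rw [Int.fract_eq_zero_iff] at h0 ⊢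
        obtain ⟨z, hz⟩ := h0
        exact ⟨(k : ℤ) ^ j * z, by push_cast; rw [hz]; ring⟩
      have hx0 : x = 0 := tendsto_nhds_unique hrec
        (tendsto_const_nhds.congr' (hzero.mono fun m hm => hm.symm))
      simp [hx0]
    · have hlim : Tendsto (fun m => (k : ℝ) ^ n * Int.fract ((k : ℝ) ^ m * x)) l
          (𝓝 ((k : ℝ) ^ n * x)) := hrec.const_mul _
      have hlt : (⌊(k : ℝ) ^ n * x⌋ : ℝ) < (k : ℝ) ^ n * x := by
        have := (Int.fract_nonneg ((k : ℝ) ^ n * x)).lt_of_ne' h0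
        rw [Int.fract] at this
        linarith
      filter_upwards [hlim.eventually_const_lt hlt,
        hlim.eventually_lt_const (Int.lt_floor_add_one _)] with m h1 h2
      exact Int.floor_eq_iff.2 ⟨h1.le, h2⟩
  filter_upwards [hfloor] with m hm
  have hsplit : (k : ℝ) ^ (n + m) * x = (k : ℝ) ^ n * Int.fract ((k : ℝ) ^ m * x) +
      ((k ^ n * ⌊(k : ℝ) ^ m * x⌋ : ℤ) : ℝ) := by
    rw [Int.fract]; push_cast; ring
  rw [hsplit, Int.fract_add_intCast, Int.fract, hm]

/-- If `x0` is recurrent along an idempotent ultrafilter under multiplication by `k` on the torus,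
then the polynomials vanishing along the orbit vanish on a rational affine subspace
which contains `x0` and the orbit. -/
theorem exists_rational_affine_subspace {d k : ℕ} (hk : 2 ≤ k) {x0 : Fin d → ℝ}
    {q : Ultrafilter ℕ} (hqidem : usum q q = q)
    (hq : ∀ N : ℕ, ∀ᶠ m in (q : Filter ℕ), N ≤ m) {x : ℕ → Fin d → ℝ}
    (hx : ∀ m i, x m i = Int.fract ((k : ℝ) ^ m * x0 i)) (hrec : Tendsto x q (𝓝 x0)) :
    ∃ (b : ℕ) (c : Fin d → ℝ) (z : Fin d → ℤ) (n : ℕ) (a : Fin n → ℝ) (u : Fin n → Fin d → ℤ),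
      0 < b ∧ (∀ i, b * c i = z i) ∧ (∀ i, x0 i = c i + ∑ j, a j * u j i) ∧
      ∀ᶠ m in (q : Filter ℕ), ∀ f : MvPolynomial (Fin d) ℝ,
        (∀ᶠ m in (q : Filter ℕ), MvPolynomial.eval (x m) f = 0) →
        ∀ δ : Fin n → ℝ, MvPolynomial.eval (fun i => x m i + ∑ j, δ j * u j i) f = 0 := by
  have hk1 : (1 : ℝ) < k := by exact_mod_cast hk
  set N : ℕ → Fin d → ℤ := fun m i => ⌊(k : ℝ) ^ m * x0 i⌋
  set c : ℕ → Fin d → ℝ := fun m i => N m i / ((k : ℝ) ^ m - 1)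
  set P : ℕ → Prop := fun m =>
    1 ≤ m ∧ PreservesEventualIdeal q x ((k : ℝ) ^ m) (fun i => -(N m i : ℝ))
  have hpow {m : ℕ} (hm : 1 ≤ m) : (2 : ℝ) ≤ (k : ℝ) ^ m := by
    have : (2 : ℝ) ≤ k := by exact_mod_cast hk
    exact this.trans (le_self_pow₀ hk1.le (by omega))
  have hcN {m : ℕ} (hm : 1 ≤ m) (i : Fin d) : ((k : ℝ) ^ m - 1) * c m i = N m i := by
    have := hpow hm
    exact mul_div_cancel₀ _ (by linarith)
  have hxN (m : ℕ) (i : Fin d) : x m i = (k : ℝ) ^ m * x0 i - N m i := by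
    rw [hx, Int.fract]
  have hPev : ∀ᶠ m in (q : Filter ℕ), P m := by
    obtain ⟨B, hB⟩ := IsNoetherian.noetherian (eventualIdeal (q : Filter ℕ) x)
    have hBmem : ∀ᶠ m in (q : Filter ℕ), ∀ f ∈ B,
        ∀ᶠ m' in (q : Filter ℕ), MvPolynomial.eval (x (m + m')) f = 0 := by
      refine (Finset.eventually_all B).2 fun f hf => ?_
      have hfI : f ∈ eventualIdeal (q : Filter ℕ) x := hB ▸ Submodule.subset_span hf
      rw [mem_eventualIdeal, ← hqidem, eventually_usum] at hfI
      exact hfI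
    filter_upwards [hBmem, hq 1] with m hm hm1
    refine ⟨hm1, fun f hf => ?_⟩
    have hle : eventualIdeal (q : Filter ℕ) x ≤
        eventualIdeal (q : Filter ℕ) fun m' => x (m + m') := by
      rw [← hB]
      exact Submodule.span_le.2 fun g hg => hm g hg
    have hshift : ∀ᶠ m' in (q : Filter ℕ), ∀ i,
        x (m + m') i = (k : ℝ) ^ m * x m' i - N m i := by
      refine eventually_all.2 fun i => ?_
      simp only [hx]
      refine eventually_fract_pow_add hq ?_ m
      simpa only [hx] using (tendsto_pi_nhds.1 hrec i)
    filter_upwards [mem_eventualIdeal.1 (hle hf), hshift] with m' h1 h2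
    rw [← h1]
    congr 2
    ext i
    simp [h2, sub_eq_add_neg]
  have hhom {m : ℕ} (hm : P m) (s : ℝ) : PreservesEventualIdeal q x s ((1 - s) • c m) := by
    refine PreservesEventualIdeal.homothety (t := (k : ℝ) ^ m) (by linarith [hpow hm.1]) ?_ s
    convert! hm.2 using 1
    ext i
    rw [Pi.smul_apply, smul_eq_mul, ← hcN hm.1]
    ring
  set G : Set (Fin d → ℝ) := {u | ∃ m m', P m ∧ P m' ∧
    u = (((k : ℝ) ^ m - 1) * ((k : ℝ) ^ m' - 1)) • (c m - c m')}
  set W : Submodule ℝ (Fin d → ℝ) := Submodule.span ℝ G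
  have hGint (u : G) : ∃ v : Fin d → ℤ, ∀ i, (u : Fin d → ℝ) i = v i := by
    obtain ⟨u, m, m', hm, hm', rfl⟩ := u
    refine ⟨fun i => (k ^ m' - 1) * N m i - (k ^ m - 1) * N m' i, fun i => ?_⟩
    push_cast
    rw [← hcN hm.1, ← hcN hm'.1]
    simp only [Pi.smul_apply, Pi.sub_apply, smul_eq_mul]
    ring
  have hcW {m m' : ℕ} (hm : P m) (hm' : P m') : c m - c m' ∈ W := by
    have h : (((k : ℝ) ^ m - 1) * ((k : ℝ) ^ m' - 1)) ≠ 0 := by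
      have := hpow hm.1
      have := hpow hm'.1
      exact mul_ne_zero (by linarith) (by linarith)
    rw [← W.smul_mem_iff h]
    exact Submodule.subset_span ⟨m, m', hm, hm', rfl⟩
  have htrans {w : Fin d → ℝ} (hw : w ∈ W) : ∀ t : ℝ, PreservesEventualIdeal q x 1 (t • w) := by
    induction hw using Submodule.span_induction with
    | mem w hw =>
      obtain ⟨m, m', hm, hm', rfl⟩ := hw
      intro t
      rw [smul_smul]
      exact PreservesEventualIdeal.translation (hhom hm) (hhom hm') _
    | zero => intro t; simpa using PreservesEventualIdeal.one_zero
    | add v w _ _ hv hw =>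
      intro t
      simpa [smul_add] using (hv t).comp (hw t)
    | smul r w _ hw => intro t; simpa [smul_smul] using hw (t * r)
  obtain ⟨m₁, hm₁⟩ := hPev.exists
  have hclim : Tendsto c q (𝓝 x0) := by
    refine tendsto_pi_nhds.2 fun i => ?_
    have hxi := tendsto_iff_dist_tendsto_zero.1 (tendsto_pi_nhds.1 hrec i)
    refine tendsto_iff_dist_tendsto_zero.2 (squeeze_zero' (Eventually.of_forall fun m => dist_nonneg)
      ?_ hxi)
    filter_upwards [hPev] with m hm
    have hkm := hpow hm.1
    have hxc : x m i - x0 i = ((k : ℝ) ^ m - 1) * (x0 i - c m i) := by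
      rw [mul_sub, hcN hm.1, hxN]; ring
    rw [dist_comm, Real.dist_eq, Real.dist_eq, hxc, abs_mul,
      abs_of_nonneg (show (0 : ℝ) ≤ (k : ℝ) ^ m - 1 by linarith)]
    exact le_mul_of_one_le_left (abs_nonneg _) (by linarith)
  have hx0W : x0 - c m₁ ∈ W :=
    W.closed_of_finiteDimensional.mem_of_tendsto (hclim.sub_const _)
      (hPev.mono fun m hm => hcW hm hm₁)
  obtain ⟨n, a, g, hag⟩ := Submodule.mem_span_set'.1 hx0W
  choose v hv using hGint
  have hb : 0 < k ^ m₁ - 1 := by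
    have : 1 < k ^ m₁ := Nat.one_lt_pow (by have := hm₁.1; omega) (by omega)
    omega
  refine ⟨k ^ m₁ - 1, c m₁, N m₁, n, a, fun j => v (g j), hb, fun i => ?_, fun i => ?_, ?_⟩
  · rw [← hcN hm₁.1, Nat.cast_sub (by omega)]
    push_cast
    rfl
  · have := congrFun hag i
    simp only [Finset.sum_apply, Pi.smul_apply, smul_eq_mul, Pi.sub_apply, hv] at this
    linarith
  · filter_upwards [hPev] with m hm f hf δ
    have hmem : (x m - c m₁) + ∑ j, δ j • (g j : Fin d → ℝ) ∈ W := by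
      refine W.add_mem ?_ (W.sum_mem fun j _ => W.smul_mem _ (Submodule.subset_span (g j).2))
      have hxm : x m - c m₁ = (x0 - c m₁) + ((k : ℝ) ^ m - 1) • ((x0 - c m₁) - (c m - c m₁)) := by
        ext i
        simp only [Pi.add_apply, Pi.sub_apply, Pi.smul_apply, smul_eq_mul, hxN]
        rw [← hcN hm.1]
        ring
      rw [hxm]
      exact W.add_mem hx0W (W.smul_mem _ (W.sub_mem hx0W (hcW hm hm₁)))
    obtain ⟨m', hm'⟩ := (((hhom hm₁ 0).comp (htrans hmem 1)) f hf).exists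
    rw [← hm']
    congr 2
    ext i
    simp only [mul_zero, zero_smul, sub_zero, one_smul, Pi.add_apply, Pi.sub_apply,
      Pi.zero_apply, Finset.sum_apply, Pi.smul_apply, smul_eq_mul, hv]
    ring

/-- Let `k ≥ 2`, `x⁰ ∈ [0,1)^d`, `xⁿ = {kⁿ x⁰}`; let `q` be a
minimal idempotent ultrafilter with `xⁿ → x⁰` along `q`, let `p ∈ βℕ₀ + q`, and let
`S ⊆ [0,1)^d` be semialgebraic with `xⁿ ∈ S` for `p`-almost all `n`. Then
`{l : {l·x⁰} ∈ S}` is IP*₊. -/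
theorem torus_uniformly_recurrent (d k : ℕ) (hk : 2 ≤ k) (x0 : Fin d → ℝ)
    (hx0 : ∀ i, x0 i ∈ Set.Ico (0 : ℝ) 1)
    (q : Ultrafilter ℕ) (hqidem : usum q q = q)
    (hqmin : ∀ r : Ultrafilter ℕ, ∃ s : Ultrafilter ℕ, usum s (usum r q) = q)
    (p : Ultrafilter ℕ) (hp : ∃ r : Ultrafilter ℕ, p = usum r q)
    (S : Set (Fin d → ℝ)) (hS : IsSemialgebraic S)
    (hSsub : S ⊆ {y | ∀ i, y i ∈ Set.Ico (0 : ℝ) 1})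
    (hrec : Filter.Tendsto
      (fun n => fun i => Int.fract ((k : ℝ) ^ n * x0 i)) ↑q (nhds x0))
    (hmem : ∀ᶠ n in ↑p, (fun i => Int.fract ((k : ℝ) ^ n * x0 i)) ∈ S) :
    IsIPStarPlus {l : ℕ | (fun i => Int.fract ((l : ℝ) * x0 i)) ∈ S} := by
  have hq := eventually_ge_of_minimal hqmin
  set x : ℕ → Fin d → ℝ := fun n i => Int.fract ((k : ℝ) ^ n * x0 i)
  have hk0 : (k : ℝ) ≠ 0 := by positivity
  obtain ⟨b, c, z, n, a, u, hb, hcz, hx0c, hvan⟩ :=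
    exists_rational_affine_subspace hk hqidem hq (x := x) (fun _ _ => rfl) hrec
  obtain ⟨r, rfl⟩ := hp
  obtain ⟨e, he⟩ := (eventually_usum.1 hmem).exists
  have hshift : ∀ᶠ m in (q : Filter ℕ), ∀ i,
      x (e + m) i = (k : ℝ) ^ e * x m i - ⌊(k : ℝ) ^ e * x0 i⌋ :=
    eventually_all.2 fun i => eventually_fract_pow_add hq (tendsto_pi_nhds.1 hrec i) e
  obtain ⟨R, F, G, rfl⟩ := hS
  simp only [Set.mem_iUnion] at he
  obtain ⟨ι, hι⟩ := Ultrafilter.eventually_exists_iff.1 he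
  have hF : ∀ f ∈ F ι, ∀ᶠ m in (q : Filter ℕ), MvPolynomial.eval (x m)
      (affineComp ((k : ℝ) ^ e) (fun i => -(⌊(k : ℝ) ^ e * x0 i⌋ : ℝ)) f) = 0 := by
    intro f hf
    filter_upwards [hι, hshift] with m hm hs
    rw [eval_affineComp, ← hm.1 f hf]
    congr 2
    ext i
    exact ((hs i).trans (sub_eq_add_neg _ _)).symm
  obtain ⟨m, hm, hs, hv⟩ := (hι.and (hshift.and hvan)).exists
  let y : (Fin n → ℝ) → Fin d → ℝ := fun δ i => x (e + m) i + ∑ j, δ j * u j i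
  have hyF (δ : Fin n → ℝ) (f) (hf : f ∈ F ι) : MvPolynomial.eval (y δ) f = 0 := by
    rw [← hv _ (hF f hf) fun j => δ j / (k : ℝ) ^ e, eval_affineComp]
    congr 2
    ext i
    simp only [y, hs, Pi.add_apply, Pi.smul_apply, smul_eq_mul, mul_add, Finset.mul_sum]
    have : ∀ j, (k : ℝ) ^ e * (δ j / (k : ℝ) ^ e * u j i) = δ j * u j i := fun j => by
      field_simp
    simp only [this]
    ring
  have hyG : ∀ᶠ δ in 𝓝 (0 : Fin n → ℝ), ∀ g ∈ G ι, 0 < MvPolynomial.eval (y δ) g := by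
    refine (Finset.eventually_all _).2 fun g hg => ?_
    have hcont : Continuous fun δ => MvPolynomial.eval (y δ) g :=
      (MvPolynomial.continuous_eval g).comp (by fun_prop)
    refine hcont.continuousAt.eventually_const_lt ?_
    have hy0 : y 0 = x (e + m) := by ext i; simp [y]
    change 0 < MvPolynomial.eval (y 0) g
    rw [hy0]
    exact hm.2 g hg
  obtain ⟨ε, hε, hball⟩ := Metric.eventually_nhds_iff.1 hyG
  refine ⟨(k ^ (e + m) : ℕ), fun A hA => ?_⟩
  obtain ⟨l, hlA, ⟨l', rfl⟩, hl⟩ := hA.exists_dvd_and_abs_sub_lt hb a hε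
  choose w hw using hl
  refine ⟨b * l', ⟨b * l' + k ^ (e + m), ?_, by push_cast; rfl⟩, hlA⟩
  let δ : Fin n → ℝ := fun j => ((b * l' : ℕ) : ℝ) * a j - w j
  have hyS : y δ ∈ ⋃ i, basicSemialg (F i) (G i) :=
    Set.mem_iUnion.2 ⟨ι, hyF δ, hball ((dist_pi_lt_iff hε).2 fun j => by
      simpa [Real.dist_eq, δ] using hw j)⟩
  have hfract : (fun i => Int.fract (((b * l' + k ^ (e + m) : ℕ) : ℝ) * x0 i)) = y δ := by
    ext i
    have hyi := hSsub hyS i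
    rw [← Int.fract_eq_self.2 hyi, Int.fract_eq_fract]
    refine ⟨l' * z i + ∑ j, w j * u j i + ⌊(k : ℝ) ^ (e + m) * x0 i⌋, ?_⟩
    have hsum : ∑ j, δ j * (u j i : ℝ) =
        (b * l' : ℝ) * ∑ j, a j * u j i - ∑ j, (w j : ℝ) * u j i := by
      rw [Finset.mul_sum, ← Finset.sum_sub_distrib]
      exact Finset.sum_congr rfl fun j _ => by simp only [δ]; push_cast; ring
    have hxi : x (e + m) i = (k : ℝ) ^ (e + m) * x0 i - ⌊(k : ℝ) ^ (e + m) * x0 i⌋ := rfl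
    have hdecomp : ∑ j, a j * (u j i : ℝ) = x0 i - c i := by rw [hx0c i]; ring
    simp only [y, hsum, hxi, hdecomp]
    push_cast
    rw [← hcz i]
    ring
  rw [Set.mem_ofPred_eq, hfract]
  exact hyS
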